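/- arXiv:1308.0748 — 2 statements merged into one kernel-verified Lean document; each statement's English description precedes it below -/
import Mathlib

section
/- Let F be an algebraically closed field of characteristic zero and let f : GL_n(F) → gl_n(F) be a regular (polynomial) map which is a cocycle for the adjoint action, i.e. f(g₁g₂) = f(g₁) + g₁ f(g₂) g₁⁻¹ for all g₁, g₂ ∈ GL_n(F). Then f is a coboundary: there exists v ∈ gl_n(F) such that f(g) = g v g⁻¹ − v for all g ∈ GL_n(F). -/
/-- A map on `GL n F` is *regular* if each matrix entry of its value is given by a
polynomial in the matrix entries of `g` together with `(det g)⁻¹`. -/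
def IsRegularMatrixMap {n : ℕ} {F : Type*} [Field F]
    (f : GL (Fin n) F → Matrix (Fin n) (Fin n) F) : Prop :=
  ∃ P : Fin n → Fin n → MvPolynomial ((Fin n × Fin n) ⊕ Unit) F,
    ∀ g : GL (Fin n) F, ∀ i j : Fin n,
      f g i j = MvPolynomial.eval
        (Sum.elim (fun q => (g : Matrix (Fin n) (Fin n) F) q.1 q.2)
          (fun _ => ((g : Matrix (Fin n) (Fin n) F).det)⁻¹)) (P i j)

open Matrix

/-- Composing a polynomial with coordinates that are Laurent polynomials in `x` gives a
Laurent polynomial in `x`. -/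
theorem MvPolynomial.exists_polynomial_pow_mul_eval {σ F : Type*} [Field F] (a : F → σ → F)
    (ha : ∀ s, ∃ (N : ℕ) (r : Polynomial F), ∀ x ≠ 0, x ^ N * a x s = r.eval x)
    (P : MvPolynomial σ F) :
    ∃ (N : ℕ) (r : Polynomial F), ∀ x ≠ 0, x ^ N * MvPolynomial.eval (a x) P = r.eval x := by
  induction P using MvPolynomial.induction_on with
  | C c => exact ⟨0, Polynomial.C c, fun x _ => by simp⟩
  | add p q hp hq =>
    obtain ⟨N, r, hr⟩ := hp
    obtain ⟨M, s, hs⟩ := hq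
    refine ⟨N + M, Polynomial.X ^ M * r + Polynomial.X ^ N * s, fun x hx => ?_⟩
    simp only [map_add, Polynomial.eval_add, Polynomial.eval_mul, Polynomial.eval_pow,
      Polynomial.eval_X, ← hr x hx, ← hs x hx]
    ring
  | mul_X p i hp =>
    obtain ⟨N, r, hr⟩ := hp
    obtain ⟨M, s, hs⟩ := ha i
    refine ⟨N + M, r * s, fun x hx => ?_⟩
    simp only [map_mul, MvPolynomial.eval_X, Polynomial.eval_mul, ← hr x hx, ← hs x hx]
    ring

/-- A homomorphism from the multiplicative group to the additive group of an algebraically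
closed field of characteristic zero vanishes if it is given by a Laurent polynomial. -/
theorem MonoidHom.eq_one_of_laurent {F : Type*} [Field F] [IsAlgClosed F] [CharZero F]
    (φ : Fˣ →* Multiplicative F) (N : ℕ) (r : Polynomial F)
    (h : ∀ x : Fˣ, (x : F) ^ N * (φ x).toAdd = r.eval (x : F)) : φ = 1 := by
  have htors : ∀ (x : Fˣ) (m : ℕ), m ≠ 0 → x ^ m = 1 → r.eval (x : F) = 0 := by
    intro x m hm hx
    have h1 : (φ (x ^ m)).toAdd = 0 := by rw [hx]; simp
    rw [map_pow, toAdd_pow, nsmul_eq_mul, mul_eq_zero] at h1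
    rw [← h, h1.resolve_left (by exact_mod_cast hm), mul_zero]
  have hr : r = 0 := by
    classical
    by_contra hr
    have hm : r.natDegree + 1 ≠ 0 := by omega
    have : NeZero ((r.natDegree + 1 : ℕ) : F) := ⟨by exact_mod_cast hm⟩
    obtain ⟨ζ, hζ⟩ := HasEnoughRootsOfUnity.exists_primitiveRoot F (r.natDegree + 1)
    have hsub : Polynomial.nthRootsFinset (r.natDegree + 1) (1 : F) ⊆ r.roots.toFinset := by
      intro x hx
      rw [Polynomial.mem_nthRootsFinset (Nat.succ_pos _)] at hx
      rw [Multiset.mem_toFinset, Polynomial.mem_roots hr]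
      have hx0 : x ≠ 0 := by
        rintro rfl
        simp at hx
      exact htors (Units.mk0 x hx0) _ hm (Units.ext (by simpa using hx))
    have h1 := (Finset.card_le_card hsub).trans
      ((Multiset.toFinset_card_le _).trans (Polynomial.card_roots' r))
    rw [hζ.card_nthRootsFinset] at h1
    omega
  ext x
  have := h x
  rw [hr, Polynomial.eval_zero, mul_eq_zero] at this
  exact this.resolve_left (pow_ne_zero _ x.ne_zero)

/-- The diagonal entries of a regular adjoint cocycle vanish on the diagonal torus. -/
theorem IsRegularMatrixMap.apply_diagonal_diag_eq_zero {n : ℕ} {F : Type*} [Field F]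
    [IsAlgClosed F] [CharZero F] {f : GL (Fin n) F → Matrix (Fin n) (Fin n) F}
    (hreg : IsRegularMatrixMap f)
    (hcoc : ∀ g₁ g₂ : GL (Fin n) F,
      f (g₁ * g₂) = f g₁ + (g₁ : Matrix (Fin n) (Fin n) F) * f g₂ *
        ((g₁⁻¹ : GL (Fin n) F) : Matrix (Fin n) (Fin n) F))
    (g : GL (Fin n) F) (d : Fin n → F) (hg : (g : Matrix (Fin n) (Fin n) F) = diagonal d)
    (k : Fin n) : f g k k = 0 := by
  let δ : (Fin n → Fˣ) →* GL (Fin n) F :=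
    { toFun := fun t => ⟨diagonal fun i => (t i : F), diagonal fun i => ((t i)⁻¹ : Fˣ),
        by simp, by simp⟩
      map_one' := by ext; simp
      map_mul' := fun s t => by ext : 1; simp }
  have hδ : ∀ t, (δ t : Matrix (Fin n) (Fin n) F) = diagonal fun i => (t i : F) := fun t => rfl
  have hδ' : ∀ t, ((δ t)⁻¹.val : Matrix (Fin n) (Fin n) F) =
    diagonal fun i => ((t i)⁻¹ : Fˣ).val := fun t => rfl
  have hadd : ∀ s t, f (δ (s * t)) k k = f (δ s) k k + f (δ t) k k := fun s t => by
    rw [map_mul, hcoc, hδ, hδ', Matrix.add_apply, mul_diagonal, diagonal_mul, mul_right_comm,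
      Units.mul_inv, one_mul]
  let φ : (Fin n → Fˣ) →* Multiplicative F :=
    MonoidHom.mk' (fun t => Multiplicative.ofAdd (f (δ t) k k)) fun s t =>
      congrArg Multiplicative.ofAdd (hadd s t)
  have hφ : φ = 1 := by
    apply MonoidHom.functions_ext
    intro i x
    obtain ⟨P, hP⟩ := hreg
    obtain ⟨N, r, hr⟩ := MvPolynomial.exists_polynomial_pow_mul_eval
      (fun x : F => (Sum.elim (fun q : Fin n × Fin n => diagonal (Pi.mulSingle i x) q.1 q.2)
        (fun _ : Unit => x⁻¹))) (by
        rintro (⟨a, b⟩ | _)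
        · rcases eq_or_ne a b with rfl | hab
          · rcases eq_or_ne a i with rfl | hai
            · exact ⟨0, Polynomial.X, by simp⟩
            · exact ⟨0, 1, by simp [hai]⟩
          · exact ⟨0, 0, by simp [hab]⟩
        · exact ⟨1, 1, fun x hx => by simp [hx]⟩) (P k k)
    have := MonoidHom.eq_one_of_laurent (φ.comp (MonoidHom.mulSingle (fun _ => Fˣ) i)) N r
      (fun x => by
        have hs : (fun j => ((Pi.mulSingle i x : Fin n → Fˣ) j : F)) =
            Pi.mulSingle i (x : F) := by
          ext j
          rcases eq_or_ne j i with rfl | hj <;> simp [*]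
        have hprod : ∏ j, (Pi.mulSingle i (x : F) : Fin n → F) j = x := by simp
        have hval : f (δ (Pi.mulSingle i x)) k k = _ := hP _ k k
        rw [hδ, det_diagonal, hs, hprod] at hval
        rw [← hr x x.ne_zero]
        exact congrArg ((x : F) ^ N * ·) hval)
    exact DFunLike.congr_fun this x
  have hd : ∀ i, d i ≠ 0 := by
    have := g.isUnit.map detMonoidHom
    rw [coe_detMonoidHom, hg, det_diagonal, isUnit_iff_ne_zero, Finset.prod_ne_zero_iff] at this
    exact fun i => this i (Finset.mem_univ i)
  have hgδ : g = δ fun i => Units.mk0 (d i) (hd i) := Units.ext hg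
  rw [hgδ]
  exact DFunLike.congr_fun hφ fun i => Units.mk0 (d i) (hd i)

section MulDerivation

variable {ι F : Type*} [Fintype ι] [DecidableEq ι] [Field F] {D : Matrix ι ι F → Matrix ι ι F}

theorem diagonal_mul_single_eq (d : ι → F) (i j : ι) (x : F) :
    diagonal d * single i j x = single i j (d i * x) := by
  ext a b
  rw [diagonal_mul]
  by_cases h : i = a ∧ j = b
  · obtain ⟨rfl, rfl⟩ := h
    simp
  · simp [single_apply_of_ne _ _ _ _ _ h]

theorem single_mul_diagonal_eq (d : ι → F) (i j : ι) (x : F) :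
    single i j x * diagonal d = single i j (x * d j) := by
  ext a b
  rw [mul_diagonal]
  by_cases h : i = a ∧ j = b
  · obtain ⟨rfl, rfl⟩ := h
    simp
  · simp [single_apply_of_ne _ _ _ _ _ h]

/-- A multiplicative derivation which vanishes on the diagonal torus is linear on each root
subgroup. -/
theorem exists_apply_transvection_eq_single [CharZero F]
    (hD : ∀ A B, A.det ≠ 0 → B.det ≠ 0 → D (A * B) = D A * B + A * D B)
    (hdiag : ∀ d : ι → F, (∀ i, d i ≠ 0) → D (diagonal d) = 0) {i j : ι} (hij : i ≠ j) :
    ∃ c : F, ∀ x, D (transvection i j x) = single i j (x * c) := by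
  have hdet : ∀ x : F, (transvection i j x).det ≠ 0 := fun x => by
    rw [det_transvection_of_ne i j hij]; exact one_ne_zero
  have hequiv : ∀ (d : ι → F), (∀ i, d i ≠ 0) → ∀ x y, y * d j = d i * x → ∀ k l,
      d k * D (transvection i j x) k l = D (transvection i j y) k l * d l := by
    intro d hd x y hxy k l
    have hddet : (diagonal d).det ≠ 0 := by
      rw [det_diagonal]; exact Finset.prod_ne_zero_iff.2 fun i _ => hd i
    have hcomm : diagonal d * transvection i j x = transvection i j y * diagonal d := by
      simp only [transvection, mul_add, add_mul, mul_one, one_mul, add_right_inj]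
      rw [diagonal_mul_single_eq, single_mul_diagonal_eq, hxy]
    have h := congrArg D hcomm
    rw [hD _ _ hddet (hdet _), hD _ _ (hdet _) hddet, hdiag d hd, zero_mul, mul_zero, zero_add,
      add_zero] at h
    simpa [diagonal_mul, mul_diagonal] using congrFun (congrFun h k) l
  have hupd : ∀ (k : ι) (a : F), a ≠ 0 → ∀ l, Function.update (1 : ι → F) k a l ≠ 0 := by
    intro k a ha l
    rcases eq_or_ne l k with rfl | h <;> simp [*]
  have hdouble : ∀ x k l, D (transvection i j (2 * x)) k l = 2 * D (transvection i j x) k l +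
      x * (D (transvection i j x) * single i j 1 + single i j 1 * D (transvection i j x) :
        Matrix ι ι F) k l := by
    intro x k l
    rw [two_mul x, ← transvection_mul_transvection_same i j hij, hD _ _ (hdet _) (hdet _)]
    have hs : transvection i j x = 1 + x • single i j 1 := by simp [transvection, smul_single]
    nth_rewrite 2 3 [hs]
    simp only [mul_add, add_mul, mul_one, one_mul, mul_smul_comm, smul_mul_assoc,
      Matrix.add_apply, Matrix.smul_apply, smul_eq_mul]
    ring
  have hji : ∀ x, D (transvection i j x) j i = 0 := by
    intro x
    have h1 := hequiv (Function.update 1 i 2) (hupd i 2 two_ne_zero) x (2 * x)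
      (by simp [hij.symm]) j i
    have h2 := hdouble x j i
    simp [hij, hij.symm] at h1 h2
    rw [h2] at h1
    linear_combination (-1 / 3 : F) * h1
  have hkk : ∀ x k, D (transvection i j x) k k = 0 := by
    intro x k
    have h1 := hequiv (Function.update 1 i 2) (hupd i 2 two_ne_zero) x (2 * x)
      (by simp [hij.symm]) k k
    rw [mul_comm, mul_left_inj' (hupd i 2 two_ne_zero k)] at h1
    have h2 := hdouble x k k
    have h3 : (D (transvection i j x) * single i j 1 : Matrix ι ι F) k k = 0 := by
      rcases eq_or_ne k j with rfl | hk
      · simp [hji]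
      · simp [hk]
    have h4 : (single i j 1 * D (transvection i j x) : Matrix ι ι F) k k = 0 := by
      rcases eq_or_ne k i with rfl | hk
      · simp [hji]
      · simp [hk]
    rw [Matrix.add_apply, h3, h4] at h2
    linear_combination -h1 - h2
  have hkl : ∀ x k l, k ≠ l → ((k ≠ i ∧ k ≠ j) ∨ (l ≠ i ∧ l ≠ j)) →
      D (transvection i j x) k l = 0 := by
    rintro x k l hkl (⟨h, h'⟩ | ⟨h, h'⟩)
    · have h1 := hequiv (Function.update 1 k 2) (hupd k 2 two_ne_zero) x x
        (by simp [h.symm, h'.symm]) k l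
      simp [hkl.symm] at h1
      linear_combination h1
    · have h1 := hequiv (Function.update 1 l 2) (hupd l 2 two_ne_zero) x x
        (by simp [h.symm, h'.symm]) k l
      simp [hkl] at h1
      linear_combination -h1
  have hlin : ∀ x, D (transvection i j x) i j = x * D (transvection i j 1) i j := by
    intro x
    rcases eq_or_ne x 0 with rfl | hx
    · have := hdiag 1 (fun _ => one_ne_zero)
      rw [Pi.one_def, diagonal_one] at this
      simp [this]
    · have h1 := hequiv (Function.update 1 i x) (hupd i x hx) 1 x (by simp [hij.symm]) i j
      simp [hij.symm] at h1
      exact h1.symm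
  refine ⟨D (transvection i j 1) i j, fun x => ?_⟩
  ext k l
  rcases eq_or_ne k l with rfl | hkl'
  · rw [hkk, single_apply_of_ne]
    rintro ⟨rfl, rfl⟩
    exact hij rfl
  · by_cases hk : k = i
    · by_cases hl : l = j
      · subst hk hl
        rw [hlin, single_apply_same]
      · rw [hkl x k l hkl' (Or.inr ⟨fun h => hkl' (hk.trans h.symm), hl⟩), single_apply_of_ne]
        exact fun h => hl h.2.symm
    · rw [single_apply_of_ne _ _ _ _ _ (fun h => hk h.1.symm)]
      by_cases hkj : k = j
      · by_cases hl : l = i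
        · subst hkj hl
          exact hji x
        · exact hkl x k l hkl' (Or.inr ⟨hl, fun h => hkl' (hkj.trans h.symm)⟩)
      · exact hkl x k l hkl' (Or.inl ⟨hk, hkj⟩)

/-- The slopes of a multiplicative derivation along opposite root subgroups are opposite. -/
theorem transvection_slope_add_swap
    (hD : ∀ A B, A.det ≠ 0 → B.det ≠ 0 → D (A * B) = D A * B + A * D B)
    {c : ι → ι → F} (hc : ∀ i j, i ≠ j → ∀ x, D (transvection i j x) = single i j (x * c i j))
    {i j : ι} (hij : i ≠ j) : c i j + c j i = 0 := by
  have hdet : ∀ {i j : ι}, i ≠ j → ∀ x : F, (transvection i j x).det ≠ 0 := fun h x => by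
    rw [det_transvection_of_ne _ _ h]; exact one_ne_zero
  have hbraid : transvection i j (1 : F) * transvection j i (-1) * transvection i j 1 =
      transvection j i (-1) * transvection i j 1 * transvection j i (-1) := by
    have hneg : transvection j i (-1 : F) = 1 - single j i 1 := by
      rw [transvection, sub_eq_add_neg, single_neg]
    rw [hneg, transvection]
    simp [mul_add, add_mul, mul_sub, sub_mul, hij, hij.symm]
    abel
  have hdet2 : ∀ {i j : ι}, i ≠ j → ∀ x y : F,
      (transvection i j x * transvection j i y).det ≠ 0 := fun h x y => by
    rw [det_mul]; exact mul_ne_zero (hdet h x) (hdet h.symm y)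
  have h := congrFun (congrFun (congrArg D hbraid) i) j
  rw [hD _ _ (hdet2 hij _ _) (hdet hij _), hD _ _ (hdet hij _) (hdet hij.symm _),
    hD _ _ (hdet2 hij.symm _ _) (hdet hij.symm _), hD _ _ (hdet hij.symm _) (hdet hij _),
    hc i j hij, hc j i hij.symm] at h
  simp [transvection, mul_add, add_mul, hij, hij.symm] at h
  linear_combination -h

/-- The slopes of a multiplicative derivation along root subgroups are additive in the roots. -/
theorem transvection_slope_add_of_ne
    (hD : ∀ A B, A.det ≠ 0 → B.det ≠ 0 → D (A * B) = D A * B + A * D B)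
    {c : ι → ι → F} (hc : ∀ i j, i ≠ j → ∀ x, D (transvection i j x) = single i j (x * c i j))
    {i j k : ι} (hij : i ≠ j) (hjk : j ≠ k) (hik : i ≠ k) : c i j + c j k = c i k := by
  have hdet : ∀ {i j : ι}, i ≠ j → ∀ x : F, (transvection i j x).det ≠ 0 := fun h x => by
    rw [det_transvection_of_ne _ _ h]; exact one_ne_zero
  have hcomm : transvection i j (1 : F) * transvection j k 1 =
      transvection i k 1 * (transvection j k 1 * transvection i j 1) := by
    simp [transvection, mul_add, add_mul, hjk.symm, hik.symm]
    abel
  have h := congrFun (congrFun (congrArg D hcomm) i) k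
  rw [hD _ _ (hdet hij _) (hdet hjk _),
    hD _ _ (hdet hik _) (by rw [det_mul]; exact mul_ne_zero (hdet hjk _) (hdet hij _)),
    hD _ _ (hdet hjk _) (hdet hij _), hc i j hij, hc j k hjk, hc i k hik] at h
  simp [transvection, mul_add, add_mul, hij.symm, hjk, hjk.symm, hik.symm] at h
  linear_combination h

/-- A multiplicative derivation on invertible matrices which vanishes on the diagonal torus is
inner. -/
theorem exists_eq_commutator_of_diagonal_eq_zero [CharZero F]
    (hD : ∀ A B, A.det ≠ 0 → B.det ≠ 0 → D (A * B) = D A * B + A * D B)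
    (hdiag : ∀ d : ι → F, (∀ i, d i ≠ 0) → D (diagonal d) = 0) :
    ∃ v, ∀ A, A.det ≠ 0 → D A = A * v - v * A := by
  rcases isEmpty_or_nonempty ι with hι | ⟨⟨o⟩⟩
  · exact ⟨0, fun A _ => Subsingleton.elim _ _⟩
  have hex : ∀ i j : ι, ∃ c : F, i ≠ j → ∀ x, D (transvection i j x) = single i j (x * c) := by
    intro i j
    by_cases hij : i = j
    · exact ⟨0, fun h => absurd hij h⟩
    · obtain ⟨c, hc⟩ := exists_apply_transvection_eq_single hD hdiag hij
      exact ⟨c, fun _ => hc⟩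
  choose c hc using hex
  let w : ι → F := fun i => if i = o then 0 else c o i
  have hw : ∀ i j, i ≠ j → c i j = w j - w i := by
    intro i j hij
    by_cases hi : i = o
    · subst hi
      simp [w, hij.symm]
    · by_cases hj : j = o
      · subst hj
        simp only [w, hi, if_true, if_false]
        linear_combination transvection_slope_add_swap hD hc hij
      · simp only [w, hi, hj, if_false]
        linear_combination transvection_slope_add_of_ne hD hc (Ne.symm hi) hij (Ne.symm hj)
  refine ⟨diagonal w, fun A hA => ?_⟩
  refine diagonal_transvection_induction_of_det_ne_zero (fun A => D A = A * _ - _ * A) A hA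
    (fun d hd => ?_) ?_ fun A B hA hB hDA hDB => ?_
  · rw [det_diagonal, Finset.prod_ne_zero_iff] at hd
    rw [hdiag d fun i => hd i (Finset.mem_univ i)]
    simp [mul_comm]
  · rintro ⟨i, j, hij, x⟩
    rw [TransvectionStruct.toMatrix_mk, hc i j hij, hw i j hij]
    rw [transvection, add_mul, mul_add, one_mul, mul_one, diagonal_mul_single_eq,
      single_mul_diagonal_eq, add_sub_add_left_eq_sub, sub_eq_add_neg (single _ _ _),
      single_neg, ← single_add]
    congr 1
    ring
  · rw [hD A B hA hB, hDA, hDB]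
    noncomm_ring

/-- A multiplicative derivation on invertible matrices whose values on the diagonal torus have
zero diagonal is inner. -/
theorem exists_eq_commutator_of_diagonal_diag_eq_zero [CharZero F] {n : ℕ}
    {D : Matrix (Fin n) (Fin n) F → Matrix (Fin n) (Fin n) F}
    (hD : ∀ A B, A.det ≠ 0 → B.det ≠ 0 → D (A * B) = D A * B + A * D B)
    (hdiag : ∀ d : Fin n → F, (∀ i, d i ≠ 0) → ∀ k, D (diagonal d) k k = 0) :
    ∃ v, ∀ A, A.det ≠ 0 → D A = A * v - v * A := by
  let s : Fin n → F := fun i => (i : ℕ) + 1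
  have hs0 : ∀ i, s i ≠ 0 := fun i => Nat.cast_add_one_ne_zero _
  have hs : ∀ k l, k ≠ l → s k - s l ≠ 0 := fun k l hkl h => hkl (by
    simpa [s, sub_eq_zero, Fin.val_inj] using h)
  have hdet : ∀ d : Fin n → F, (∀ i, d i ≠ 0) → (diagonal d).det ≠ 0 := fun d hd => by
    rw [det_diagonal]; exact Finset.prod_ne_zero_iff.2 fun i _ => hd i
  let v : Matrix (Fin n) (Fin n) F := fun k l => D (diagonal s) k l / (s k - s l)
  obtain ⟨u, hu⟩ := exists_eq_commutator_of_diagonal_eq_zero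
    (D := fun A => D A - (A * v - v * A))
    (fun A B hA hB => by rw [hD A B hA hB]; noncomm_ring) (fun d hd => by
      ext k l
      rw [Matrix.sub_apply, Matrix.sub_apply, diagonal_mul, mul_diagonal, Matrix.zero_apply]
      rcases eq_or_ne k l with rfl | hkl
      · rw [hdiag d hd]; ring
      · have h := congrFun (congrFun (congrArg D (commute_diagonal d s).eq) k) l
        rw [hD _ _ (hdet d hd) (hdet s hs0), hD _ _ (hdet s hs0) (hdet d hd)] at h
        simp only [Matrix.add_apply, diagonal_mul, mul_diagonal] at h
        have := hs k l hkl
        simp only [v]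
        field_simp
        linear_combination -h)
  refine ⟨v + u, fun A hA => ?_⟩
  have := hu A hA
  rw [sub_eq_iff_eq_add] at this
  rw [this]
  noncomm_ring

end MulDerivation

/-- Every regular cocycle `GL_n(F) → gl_n(F)` for the adjoint action over an algebraically
closed field of characteristic zero is a coboundary. -/
theorem statement0 {n : ℕ} {F : Type*} [Field F] [IsAlgClosed F] [CharZero F]
    (f : GL (Fin n) F → Matrix (Fin n) (Fin n) F)
    (hreg : IsRegularMatrixMap f)
    (hcoc : ∀ g₁ g₂ : GL (Fin n) F,
      f (g₁ * g₂) = f g₁ + (g₁ : Matrix (Fin n) (Fin n) F) * f g₂ *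
        ((g₁⁻¹ : GL (Fin n) F) : Matrix (Fin n) (Fin n) F)) :
    ∃ v : Matrix (Fin n) (Fin n) F, ∀ g : GL (Fin n) F,
      f g = (g : Matrix (Fin n) (Fin n) F) * v *
        ((g⁻¹ : GL (Fin n) F) : Matrix (Fin n) (Fin n) F) - v := by
  classical
  let D : Matrix (Fin n) (Fin n) F → Matrix (Fin n) (Fin n) F := fun A =>
    if h : A.det ≠ 0 then f (GeneralLinearGroup.mkOfDetNeZero A h) * A else 0
  have hDg : ∀ g : GL (Fin n) F, D g = f g * (g : Matrix (Fin n) (Fin n) F) := by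
    intro g
    have hg : (g : Matrix (Fin n) (Fin n) F).det ≠ 0 := g.det_ne_zero
    have : GeneralLinearGroup.mkOfDetNeZero (g : Matrix (Fin n) (Fin n) F) hg = g := Units.ext rfl
    simp only [D, dif_pos hg, this]
  have hlift : ∀ A : Matrix (Fin n) (Fin n) F, A.det ≠ 0 → ∃ g : GL (Fin n) F, g = A :=
    fun A hA => ⟨GeneralLinearGroup.mkOfDetNeZero A hA, rfl⟩
  obtain ⟨v, hv⟩ := exists_eq_commutator_of_diagonal_diag_eq_zero (D := D)
    (fun A B hA hB => by
      obtain ⟨g, rfl⟩ := hlift A hA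
      obtain ⟨h, rfl⟩ := hlift B hB
      rw [← Units.val_mul, hDg, hDg, hDg, hcoc, Units.val_mul, add_mul, mul_assoc, mul_assoc,
        Units.inv_mul_cancel_left, mul_assoc])
    (fun d hd k => by
      obtain ⟨g, hg⟩ := hlift (diagonal d) (by
        rw [det_diagonal]; exact Finset.prod_ne_zero_iff.2 fun i _ => hd i)
      rw [← hg, hDg, hg, mul_diagonal, hreg.apply_diagonal_diag_eq_zero hcoc g d hg, zero_mul])
  refine ⟨v, fun g => ?_⟩
  have h := hv g g.det_ne_zero
  rw [hDg] at h
  rw [← Units.mul_inv_cancel_right (f g) g, h, sub_mul, Units.mul_inv_cancel_right]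
end

section
/- In the proof of the cocycle lemma: if f : GL_n(F) → gl_n(F) is a regular cocycle for the adjoint action over an algebraically closed field F of characteristic zero, then the trace of f is identically zero, i.e. f takes values in sl_n(F). -/
open Polynomial in
/-- A monoid homomorphism from `Fˣ` to the additive group of `F` that becomes polynomial after
multiplication by a power of the variable is trivial. -/
theorem eq_zero_of_units_hom_of_laurent {F : Type*} [Field F] [IsAlgClosed F] [CharZero F]
    (φ : Fˣ →* Multiplicative F) (N : ℕ) (Q : F[X])
    (hQ : ∀ s : Fˣ, (s : F) ^ N * (φ s).toAdd = Q.eval (s : F)) (s : Fˣ) :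
    (φ s).toAdd = 0 := by
  suffices h : Q = 0 by
    have := hQ s
    rw [h, eval_zero] at this
    exact (mul_eq_zero.mp this).resolve_left (pow_ne_zero _ s.ne_zero)
  by_contra hne
  have : NeZero ((Q.natDegree + 1 : ℕ) : F) := ⟨Nat.cast_ne_zero.mpr (Nat.succ_ne_zero _)⟩
  obtain ⟨ζ, hζ⟩ := HasEnoughRootsOfUnity.exists_primitiveRoot F (Q.natDegree + 1)
  have hroot : ∀ x ∈ nthRootsFinset (Q.natDegree + 1) (1 : F), Q.eval x = 0 := by
    intro x hx
    have hx1 : x ^ (Q.natDegree + 1) = 1 := (mem_nthRootsFinset (Nat.succ_pos _) _).mp hx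
    obtain ⟨u, rfl⟩ : IsUnit x := IsUnit.of_pow_eq_one hx1 (Nat.succ_ne_zero _)
    have hu : u ^ (Q.natDegree + 1) = 1 := by ext; simpa using hx1
    have h0 : (Q.natDegree + 1) • (φ u).toAdd = 0 := by
      rw [← toAdd_pow, ← map_pow, hu, map_one, toAdd_one]
    rw [← hQ u, (smul_eq_zero.mp h0).resolve_left (Nat.succ_ne_zero _), mul_zero]
  refine hne (eq_zero_of_natDegree_lt_card_of_eval_eq_zero' Q _ hroot ?_)
  rw [hζ.card_nthRootsFinset]
  exact Nat.lt_succ_self _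

open Polynomial in
/-- Evaluating a multivariate polynomial at functions of the form `s ↦ s⁻ᵏ q(s)` gives a function
of the same form. -/
theorem MvPolynomial.exists_pow_mul_eval_eq_eval {F σ : Type*} [Field F] (a : σ → Fˣ → F)
    (ha : ∀ i, ∃ (N : ℕ) (Q : F[X]), ∀ s : Fˣ, (s : F) ^ N * a i s = Q.eval (s : F))
    (R : MvPolynomial σ F) :
    ∃ (N : ℕ) (Q : F[X]), ∀ s : Fˣ,
      (s : F) ^ N * MvPolynomial.eval (fun i => a i s) R = Q.eval (s : F) := by
  induction R using MvPolynomial.induction_on with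
  | C c => exact ⟨0, Polynomial.C c, fun s => by simp⟩
  | add p q hp hq =>
    obtain ⟨N, P, hP⟩ := hp
    obtain ⟨M, Q, hQ⟩ := hq
    refine ⟨N + M, Polynomial.X ^ M * P + Polynomial.X ^ N * Q, fun s => ?_⟩
    simp only [map_add, Polynomial.eval_add, Polynomial.eval_mul, Polynomial.eval_pow,
      Polynomial.eval_X, ← hP, ← hQ]
    ring
  | mul_X p i hp =>
    obtain ⟨N, P, hP⟩ := hp
    obtain ⟨M, Q, hQ⟩ := ha i
    refine ⟨N + M, P * Q, fun s => ?_⟩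
    simp only [map_mul, MvPolynomial.eval_X, Polynomial.eval_mul, ← hP, ← hQ]
    ring

/-- The embedding of the diagonal torus into `GL n F`. -/
def diagonalGL (n : ℕ) (F : Type*) [Field F] : (Fin n → Fˣ) →* GL (Fin n) F :=
  (Units.map (Matrix.diagonalRingHom (Fin n) F).toMonoidHom).comp
    (MulEquiv.piUnits (M := fun _ : Fin n => F)).symm.toMonoidHom

theorem coe_diagonalGL {n : ℕ} {F : Type*} [Field F] (v : Fin n → Fˣ) :
    (diagonalGL n F v : Matrix (Fin n) (Fin n) F) = Matrix.diagonal fun i => (v i : F) := rfl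

/-- A regular homomorphism from `GL n F` to the additive group of `F` vanishes on the diagonal
torus. -/
theorem regular_hom_diagonalGL_eq_zero {n : ℕ} {F : Type*} [Field F] [IsAlgClosed F] [CharZero F]
    (t : GL (Fin n) F →* Multiplicative F) (R : MvPolynomial ((Fin n × Fin n) ⊕ Unit) F)
    (hR : ∀ g : GL (Fin n) F, (t g).toAdd = MvPolynomial.eval
        (Sum.elim (fun q => (g : Matrix (Fin n) (Fin n) F) q.1 q.2)
          (fun _ => ((g : Matrix (Fin n) (Fin n) F).det)⁻¹)) R) (v : Fin n → Fˣ) :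
    t (diagonalGL n F v) = 1 := by
  suffices h : t.comp (diagonalGL n F) = 1 from DFunLike.congr_fun h v
  refine MonoidHom.functions_ext _ _ _ fun i s => ?_
  let a : (Fin n × Fin n) ⊕ Unit → Fˣ → F := fun x s =>
    Sum.elim
      (fun q => (diagonalGL n F (Pi.mulSingle i s) : Matrix (Fin n) (Fin n) F) q.1 q.2)
      (fun _ => ((diagonalGL n F (Pi.mulSingle i s) : Matrix (Fin n) (Fin n) F).det)⁻¹) x
  obtain ⟨N, Q, hQ⟩ := MvPolynomial.exists_pow_mul_eval_eq_eval a (by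
    rintro (⟨j, k⟩ | _)
    · by_cases hjk : j = k
      · subst hjk
        by_cases hj : j = i
        · subst hj
          exact ⟨0, Polynomial.X, fun s => by simp [a, coe_diagonalGL]⟩
        · exact ⟨0, 1, fun s => by simp [a, coe_diagonalGL, hj]⟩
      · exact ⟨0, 0, fun s => by simp [a, coe_diagonalGL, hjk]⟩
    · refine ⟨1, 1, fun s => ?_⟩
      have : (diagonalGL n F (Pi.mulSingle i s) : Matrix (Fin n) (Fin n) F).det = s := by
        rw [coe_diagonalGL, Matrix.det_diagonal, ← Units.coe_prod, Finset.prod_pi_mulSingle',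
          if_pos (Finset.mem_univ i)]
      simp [a, this]) R
  exact eq_zero_of_units_hom_of_laurent
    ((t.comp (diagonalGL n F)).comp (MonoidHom.mulSingle (fun _ : Fin n => Fˣ) i)) N Q
    (fun s => by rw [← hQ s]; exact congrArg _ (hR _)) s

/-- A homomorphism from `GL n F` to the additive group of a field of characteristic zero vanishes
on transvections. -/
theorem hom_eq_one_of_coe_eq_transvection {n : ℕ} {F : Type*} [Field F] [CharZero F]
    (t : GL (Fin n) F →* Multiplicative F) {i j : Fin n} (hij : i ≠ j) (c : F)
    (g : GL (Fin n) F) (hg : (g : Matrix (Fin n) (Fin n) F) = Matrix.transvection i j c) :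
    t g = 1 := by
  let d : GL (Fin n) F := diagonalGL n F (Pi.mulSingle i (Units.mk0 2 two_ne_zero))
  have h : d * g = g * g * d := by
    ext k l
    simp only [Units.val_mul, hg, d, coe_diagonalGL,
      Matrix.transvection_mul_transvection_same _ _ hij]
    rw [Matrix.diagonal_mul, Matrix.mul_diagonal]
    by_cases hk : k = i <;> by_cases hl : l = j <;> by_cases hkl : k = l <;>
      simp_all [Matrix.transvection, Pi.mulSingle_apply, Matrix.single_apply, eq_comm]
    ring
  have h' := congrArg t h
  simp only [map_mul] at h'
  rw [mul_comm, mul_left_inj] at h'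
  exact left_eq_mul.mp h'

/-- `GL n F` has no nontrivial regular homomorphism to the additive group. -/
theorem regular_hom_eq_one {n : ℕ} {F : Type*} [Field F] [IsAlgClosed F] [CharZero F]
    (t : GL (Fin n) F →* Multiplicative F) (R : MvPolynomial ((Fin n × Fin n) ⊕ Unit) F)
    (hR : ∀ g : GL (Fin n) F, (t g).toAdd = MvPolynomial.eval
        (Sum.elim (fun q => (g : Matrix (Fin n) (Fin n) F) q.1 q.2)
          (fun _ => ((g : Matrix (Fin n) (Fin n) F).det)⁻¹)) R) (g : GL (Fin n) F) :
    t g = 1 := by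
  refine Matrix.diagonal_transvection_induction_of_det_ne_zero
    (fun M => ∀ g : GL (Fin n) F, (g : Matrix (Fin n) (Fin n) F) = M → t g = 1)
    (g : Matrix (Fin n) (Fin n) F) (Matrix.GeneralLinearGroup.det g).ne_zero ?_ ?_ ?_ g rfl
  · intro D hD g hg
    rw [Matrix.det_diagonal, Finset.prod_ne_zero_iff] at hD
    obtain rfl : g = diagonalGL n F fun i => Units.mk0 (D i) (hD i (Finset.mem_univ i)) :=
      Units.ext hg
    exact regular_hom_diagonalGL_eq_zero t R hR _
  · intro T g hg
    exact hom_eq_one_of_coe_eq_transvection t T.hij T.c g hg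
  · intro A B hA hB ihA ihB g hg
    obtain rfl : g = Matrix.GeneralLinearGroup.mkOfDetNeZero A hA *
        Matrix.GeneralLinearGroup.mkOfDetNeZero B hB := Units.ext hg
    rw [map_mul, ihA _ rfl, ihB _ rfl, one_mul]

/-- A regular adjoint cocycle `GL_n(F) → gl_n(F)` over an algebraically closed field of
characteristic zero has identically vanishing trace, i.e. takes values in `sl_n(F)`. -/
theorem statement1 {n : ℕ} {F : Type*} [Field F] [IsAlgClosed F] [CharZero F]
    (f : GL (Fin n) F → Matrix (Fin n) (Fin n) F)
    (hreg : IsRegularMatrixMap f)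
    (hcoc : ∀ g₁ g₂ : GL (Fin n) F,
      f (g₁ * g₂) = f g₁ + (g₁ : Matrix (Fin n) (Fin n) F) * f g₂ *
        ((g₁⁻¹ : GL (Fin n) F) : Matrix (Fin n) (Fin n) F)) :
    ∀ g : GL (Fin n) F, (f g).trace = 0 := by
  obtain ⟨P, hP⟩ := hreg
  intro g
  let t : GL (Fin n) F →* Multiplicative F :=
    MonoidHom.mk' (fun g => Multiplicative.ofAdd (f g).trace) fun g₁ g₂ => by
      rw [hcoc, Matrix.trace_add, Matrix.trace_mul_cycle, ← Units.val_mul, inv_mul_cancel,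
        Units.val_one, one_mul, ofAdd_add]
  refine regular_hom_eq_one t (∑ i, P i i) (fun g => ?_) g
  rw [map_sum]
  change ∑ i, f g i i = _
  exact Finset.sum_congr rfl fun i _ => hP g i i
end
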